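/- (Gradient of the mode-seeking KL objective / Euler–Lagrange equation of Section 5.2.) Let f : ℝ^d → ℝ be continuously differentiable and such that, for fixed x_k and τ > 0, the map x ↦ D_KL(φ_{x,τ}‖q_{x_k,τ}) is differentiable with differentiation under the integral sign valid and E_{Y∼φ_{x,τ}}[∇f(Y)] finite for all x. Then the gradient of this map at x equals (1/τ)(x − x_k + τ E_{Y∼φ_{x,τ}}[∇f(Y)]); in particular, x is a critical point of x ↦ D_KL(φ_{x,τ}‖q_{x_k,τ}) if and only if h(x) := x − x_k + τ E_{Y∼φ_{x,τ}}[∇f(Y)] = 0. -/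

import Mathlib

open MeasureTheory Real

/-- Gaussian density on `ℝ^d` with mean `x` and covariance `τ I`. -/
noncomputable def phi (d : ℕ) (τ : ℝ) (x x' : EuclideanSpace ℝ (Fin d)) : ℝ :=
  (2 * π * τ) ^ (-(d : ℝ) / 2) * Real.exp (-‖x' - x‖ ^ 2 / (2 * τ))

/-- Kullback–Leibler divergence `∫ p log (p / q)` between densities on `ℝ^d`. -/
noncomputable def KL (d : ℕ) (p q : EuclideanSpace ℝ (Fin d) → ℝ) : ℝ :=
  ∫ y, p y * Real.log (p y / q y)

/-- Normalizing constant `Z_{x,τ} = ∫ exp (-f) φ_{x,τ}`. -/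
noncomputable def Z (d : ℕ) (τ : ℝ) (f : EuclideanSpace ℝ (Fin d) → ℝ)
    (x : EuclideanSpace ℝ (Fin d)) : ℝ :=
  ∫ x', Real.exp (-f x') * phi d τ x x'

/-- The density `q_{x,τ} = Z_{x,τ}⁻¹ exp (-f) φ_{x,τ}`. -/
noncomputable def qdens (d : ℕ) (τ : ℝ) (f : EuclideanSpace ℝ (Fin d) → ℝ)
    (x x' : EuclideanSpace ℝ (Fin d)) : ℝ :=
  (Z d τ f x)⁻¹ * (Real.exp (-f x') * phi d τ x x')

section GaussianMoments

variable {d : ℕ} {τ : ℝ}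

lemma phi_pos (hτ : 0 < τ) (x z : EuclideanSpace ℝ (Fin d)) : 0 < phi d τ x z := by
  unfold phi; positivity

lemma phi_eq_phi_zero_sub (x z : EuclideanSpace ℝ (Fin d)) :
    phi d τ x z = phi d τ 0 (z - x) := by
  simp [phi]

lemma integral_phi_zero (hτ : 0 < τ) : ∫ z, phi d τ 0 z = 1 := by
  have h := GaussianFourier.integral_rexp_neg_mul_sq_norm (V := EuclideanSpace ℝ (Fin d))
    (b := (2 * τ)⁻¹) (by positivity)
  have hb : π / (2 * τ)⁻¹ = 2 * π * τ := by field_simp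
  rw [finrank_euclideanSpace_fin, hb] at h
  have e (z : EuclideanSpace ℝ (Fin d)) : phi d τ 0 z =
      (2 * π * τ) ^ (-(d : ℝ) / 2) * Real.exp (-(2 * τ)⁻¹ * ‖z‖ ^ 2) := by
    rw [phi, sub_zero]; congr 2; ring
  simp_rw [e]
  rw [integral_const_mul, h, ← Real.rpow_add (by positivity)]
  ring_nf
  simp

lemma integral_phi (hτ : 0 < τ) (x : EuclideanSpace ℝ (Fin d)) : ∫ z, phi d τ x z = 1 := by
  simp_rw [phi_eq_phi_zero_sub x]
  rw [integral_sub_right_eq_self (phi d τ 0), integral_phi_zero hτ]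

lemma integrable_phi (hτ : 0 < τ) (x : EuclideanSpace ℝ (Fin d)) : Integrable (phi d τ x) :=
  Integrable.of_integral_ne_zero (by rw [integral_phi hτ]; exact one_ne_zero)

lemma continuous_phi (x : EuclideanSpace ℝ (Fin d)) : Continuous (phi d τ x) := by
  unfold phi; fun_prop

lemma norm_mul_phi_zero_le (hτ : 0 < τ) (z : EuclideanSpace ℝ (Fin d)) :
    ‖z‖ * phi d τ 0 z ≤ (2 * π * τ) ^ (-(d : ℝ) / 2) * (1 + τ) *
      ((2 * π * (2 * τ)) ^ (-(d : ℝ) / 2))⁻¹ * phi d (2 * τ) 0 z := by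
  have key : ‖z‖ * Real.exp (-‖z‖ ^ 2 / (2 * τ)) ≤
      (1 + τ) * Real.exp (-‖z‖ ^ 2 / (2 * (2 * τ))) := by
    have h1 := Real.add_one_le_exp (‖z‖ ^ 2 / (4 * τ))
    have h2 : ‖z‖ ≤ (1 + τ) * (‖z‖ ^ 2 / (4 * τ) + 1) := by
      have : (1 + τ) * (‖z‖ ^ 2 / (4 * τ) + 1) - ‖z‖ =
          (‖z‖ - 2 * τ) ^ 2 / (4 * τ) + ‖z‖ ^ 2 / 4 + 1 := by
        field_simp; ring
      have : 0 ≤ (‖z‖ - 2 * τ) ^ 2 / (4 * τ) + ‖z‖ ^ 2 / 4 + 1 := by positivity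
      linarith
    have h3 : Real.exp (-‖z‖ ^ 2 / (2 * (2 * τ))) =
        Real.exp (‖z‖ ^ 2 / (4 * τ)) * Real.exp (-‖z‖ ^ 2 / (2 * τ)) := by
      rw [← Real.exp_add]; congr 1; field_simp; ring
    rw [h3, ← mul_assoc]
    gcongr
    exact h2.trans (by gcongr)
  have hc : (0 : ℝ) < (2 * π * (2 * τ)) ^ (-(d : ℝ) / 2) := by positivity
  simp only [phi, sub_zero]
  calc _ = (2 * π * τ) ^ (-(d : ℝ) / 2) * (‖z‖ * Real.exp (-‖z‖ ^ 2 / (2 * τ))) := by ring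
    _ ≤ (2 * π * τ) ^ (-(d : ℝ) / 2) *
        ((1 + τ) * Real.exp (-‖z‖ ^ 2 / (2 * (2 * τ)))) := by gcongr
    _ = _ := by field_simp

lemma integrable_inner_mul_phi_zero (hτ : 0 < τ) (v : EuclideanSpace ℝ (Fin d)) :
    Integrable (fun z => inner ℝ z v * phi d τ 0 z) := by
  refine (((integrable_phi (by positivity : 0 < 2 * τ) 0).const_mul
    ((2 * π * τ) ^ (-(d : ℝ) / 2) * (1 + τ) *
      ((2 * π * (2 * τ)) ^ (-(d : ℝ) / 2))⁻¹)).const_mul ‖v‖).mono' ?_ ?_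
  · have := continuous_phi (τ := τ) (0 : EuclideanSpace ℝ (Fin d))
    exact (by fun_prop : Continuous _).aestronglyMeasurable
  · refine Filter.Eventually.of_forall fun z => ?_
    rw [norm_mul, Real.norm_of_nonneg (phi_pos hτ 0 z).le]
    calc _ ≤ ‖z‖ * ‖v‖ * phi d τ 0 z := by
          gcongr
          · exact (phi_pos hτ 0 z).le
          · exact norm_inner_le_norm z v
      _ = ‖v‖ * (‖z‖ * phi d τ 0 z) := by ring
      _ ≤ _ := mul_le_mul_of_nonneg_left (norm_mul_phi_zero_le hτ z) (norm_nonneg v)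

lemma integrable_inner_sub_mul_phi (hτ : 0 < τ) (x v : EuclideanSpace ℝ (Fin d)) :
    Integrable (fun z => inner ℝ (z - x) v * phi d τ x z) := by
  simp_rw [phi_eq_phi_zero_sub x]
  exact (integrable_inner_mul_phi_zero hτ v).comp_sub_right x

lemma integral_inner_sub_mul_phi (x v : EuclideanSpace ℝ (Fin d)) :
    ∫ z, inner ℝ (z - x) v * phi d τ x z = 0 := by
  simp_rw [phi_eq_phi_zero_sub x]
  rw [integral_sub_right_eq_self (fun z => inner ℝ z v * phi d τ 0 z)]
  have h := integral_neg_eq_self (fun z => inner ℝ z v * phi d τ 0 z) volume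
  have e (z : EuclideanSpace ℝ (Fin d)) : inner ℝ (-z) v * phi d τ 0 (-z) =
      -(inner ℝ z v * phi d τ 0 z) := by
    simp [phi]
  simp_rw [e, integral_neg] at h
  linarith

end GaussianMoments

lemma log_phi_div_qdens {d : ℕ} {τ : ℝ} (hτ : 0 < τ) {f : EuclideanSpace ℝ (Fin d) → ℝ}
    {xk : EuclideanSpace ℝ (Fin d)} (hZpos : 0 < Z d τ f xk) (y z : EuclideanSpace ℝ (Fin d)) :
    Real.log (phi d τ y z / qdens d τ f xk z) = f z + τ⁻¹ * inner ℝ (z - y) (y - xk) +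
      (Real.log (Z d τ f xk) + (2 * τ)⁻¹ * ‖y - xk‖ ^ 2) := by
  have hc : (0 : ℝ) < (2 * π * τ) ^ (-(d : ℝ) / 2) := by positivity
  have e : phi d τ y z / qdens d τ f xk z = Z d τ f xk *
      Real.exp (f z + (-‖z - y‖ ^ 2 / (2 * τ) - -‖z - xk‖ ^ 2 / (2 * τ))) := by
    rw [Real.exp_add, Real.exp_sub, qdens, phi, phi, Real.exp_neg]
    field_simp
  have hn : ‖z - xk‖ ^ 2 = ‖z - y‖ ^ 2 + 2 * inner ℝ (z - y) (y - xk) + ‖y - xk‖ ^ 2 := by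
    rw [← norm_add_sq_real, sub_add_sub_cancel]
  rw [e, Real.log_mul hZpos.ne' (Real.exp_ne_zero _), Real.log_exp, hn]
  field_simp
  ring

/-- The divergence from `φ_y` to `q_{xk}` is the mean of `f` plus a quadratic term. -/
lemma KL_phi_qdens {d : ℕ} {τ : ℝ} (hτ : 0 < τ) {f : EuclideanSpace ℝ (Fin d) → ℝ}
    {xk : EuclideanSpace ℝ (Fin d)} (hZpos : 0 < Z d τ f xk) {y : EuclideanSpace ℝ (Fin d)}
    (hKL : Integrable (fun z => phi d τ y z * Real.log (phi d τ y z / qdens d τ f xk z))) :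
    KL d (phi d τ y) (qdens d τ f xk) = (∫ z, f z * phi d τ y z) +
      (Real.log (Z d τ f xk) + (2 * τ)⁻¹ * ‖y - xk‖ ^ 2) := by
  have hI := (integrable_inner_sub_mul_phi hτ y (y - xk)).const_mul τ⁻¹
  have hC := (integrable_phi hτ y).const_mul
    (Real.log (Z d τ f xk) + (2 * τ)⁻¹ * ‖y - xk‖ ^ 2)
  have e (z : EuclideanSpace ℝ (Fin d)) :
      phi d τ y z * Real.log (phi d τ y z / qdens d τ f xk z) =
      f z * phi d τ y z + τ⁻¹ * (inner ℝ (z - y) (y - xk) * phi d τ y z) +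
      (Real.log (Z d τ f xk) + (2 * τ)⁻¹ * ‖y - xk‖ ^ 2) * phi d τ y z := by
    rw [log_phi_div_qdens hτ hZpos]; ring
  simp_rw [e] at hKL
  have hf : Integrable (fun z => f z * phi d τ y z) := by
    refine ((hKL.sub hC).sub hI).congr (Filter.Eventually.of_forall fun z => ?_)
    simp only [Pi.sub_apply]; ring
  simp_rw [KL, e]
  rw [integral_add (by exact hf.add hI) hC, integral_add hf hI, integral_const_mul,
    integral_const_mul, integral_inner_sub_mul_phi, integral_phi hτ]
  ring

lemma hasGradientAt_norm_sub_sq {E : Type*} [NormedAddCommGroup E] [InnerProductSpace ℝ E]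
    [CompleteSpace E] (a x : E) :
    HasGradientAt (fun u => ‖u - a‖ ^ 2) ((2 : ℝ) • (x - a)) x := by
  rw [hasGradientAt_iff_hasFDerivAt]
  refine ((hasFDerivAt_id x).sub_const a).norm_sq.congr_fderiv ?_
  ext v
  simp

theorem stmt14 (d : ℕ) (τ : ℝ) (hτ : 0 < τ)
    (f : EuclideanSpace ℝ (Fin d) → ℝ) (hfb : ∃ C, ∀ y, C ≤ f y)
    (hfC1 : ContDiff ℝ 1 f)
    (xk : EuclideanSpace ℝ (Fin d))
    (hZint : Integrable (fun x' => Real.exp (-f x') * phi d τ xk x'))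
    (hZpos : 0 < Z d τ f xk)
    (hKLfin : ∀ y, Integrable
      (fun z => phi d τ y z * Real.log (phi d τ y z / qdens d τ f xk z)))
    (hgradint : ∀ y, Integrable (fun z => phi d τ y z • gradient f z))
    (hdui : ∀ y, HasGradientAt (fun u => ∫ z, f z * phi d τ u z)
      (∫ z, phi d τ y z • gradient f z) y)
    (x : EuclideanSpace ℝ (Fin d)) :
    HasGradientAt (fun u => KL d (phi d τ u) (qdens d τ f xk))
      (τ⁻¹ • (x - xk + τ • ∫ z, phi d τ x z • gradient f z)) x ∧
    (gradient (fun u => KL d (phi d τ u) (qdens d τ f xk)) x = 0 ↔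
      x - xk + τ • (∫ z, phi d τ x z • gradient f z) = 0) := by
  have hgrad : HasGradientAt (fun u => KL d (phi d τ u) (qdens d τ f xk))
      (τ⁻¹ • (x - xk + τ • ∫ z, phi d τ x z • gradient f z)) x := by
    have hKL : (fun u => KL d (phi d τ u) (qdens d τ f xk)) = fun u =>
        (∫ z, f z * phi d τ u z) +
          (Real.log (Z d τ f xk) + (2 * τ)⁻¹ * ‖u - xk‖ ^ 2) :=
      funext fun u => KL_phi_qdens hτ hZpos (hKLfin u)
    rw [hKL, hasGradientAt_iff_hasFDerivAt]
    have hq := (hasGradientAt_norm_sub_sq xk x).hasFDerivAt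
    refine ((hdui x).hasFDerivAt.add
      ((hq.const_mul (2 * τ)⁻¹).const_add (Real.log (Z d τ f xk)))).congr_fderiv ?_
    rw [← map_smul, ← map_add]
    congr 1
    rw [smul_add, smul_smul, smul_smul, inv_mul_cancel₀ hτ.ne', one_smul, add_comm]
    congr 2
    field_simp
  refine ⟨hgrad, ?_⟩
  rw [hgrad.gradient, smul_eq_zero_iff_right (inv_ne_zero hτ.ne')]
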